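/- Let L be a lattice (finite-rank free ℤ-module) with a nondegenerate symmetric bilinear form q of signature (r, s) with r ≥ 3 and s ≥ 2, set V = L ⊗ ℂ. Then any finite-index subgroup D of SO(L, q) is Zariski dense in the complex algebraic group SO(V, q). -/

import Mathlib

open Matrix

namespace Matrix

theorem dotProduct_mulVec_symm {ι R : Type*} [Fintype ι] [CommRing R] {B : Matrix ι ι R}
    (hB : Bᵀ = B) (x y : ι → R) : x ⬝ᵥ B *ᵥ y = y ⬝ᵥ B *ᵥ x := by
  rw [dotProduct_mulVec, ← mulVec_transpose, hB, dotProduct_comm]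

theorem dotProduct_mulVec_mulVec_of_isometry {ι R : Type*} [Fintype ι] [CommRing R]
    {B g : Matrix ι ι R} (hg : gᵀ * B * g = B) (x y : ι → R) : (g *ᵥ x) ⬝ᵥ B *ᵥ (g *ᵥ y) = x ⬝ᵥ B *ᵥ y := by
  conv_rhs => rw [← hg]
  rw [← mulVec_mulVec, ← mulVec_mulVec, dotProduct_mulVec x, vecMul_transpose]

section Reflection

variable {ι K : Type*} [Fintype ι] [DecidableEq ι] [Field K] {B : Matrix ι ι K}

/-- The reflection `z ↦ z - 2 b(v, z) / b(v, v) • v` of the bilinear form with Gram matrix `B`. -/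
def formReflection (B : Matrix ι ι K) (v : ι → K) : Matrix ι ι K :=
  1 - (2 / (v ⬝ᵥ B *ᵥ v)) • vecMulVec v (B *ᵥ v)

theorem formReflection_mulVec (hB : Bᵀ = B) (v z : ι → K) :
    formReflection B v *ᵥ z = z - (2 * (v ⬝ᵥ B *ᵥ z) / (v ⬝ᵥ B *ᵥ v)) • v := by
  rw [formReflection, sub_mulVec, one_mulVec, smul_mulVec, vecMulVec_mulVec,
    dotProduct_comm (B *ᵥ v) z, dotProduct_mulVec_symm hB z v]
  ext i
  simp
  ring

theorem mul_formReflection_of_isometry {g : Matrix ι ι K} (hg : gᵀ * B * g = B) (v : ι → K) :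
    g * formReflection B v = formReflection B (g *ᵥ v) * g := by
  have h : (B *ᵥ (g *ᵥ v)) ᵥ* g = B *ᵥ v := by
    conv_rhs => rw [← hg]
    rw [← mulVec_transpose, mulVec_mulVec, mulVec_mulVec, Matrix.mul_assoc]
  rw [formReflection, formReflection, Matrix.mul_sub, Matrix.sub_mul, Matrix.mul_smul,
    Matrix.smul_mul, mul_vecMulVec, vecMulVec_mul, h, dotProduct_mulVec_mulVec_of_isometry hg,
    Matrix.mul_one, Matrix.one_mul]

theorem formReflection_mul_self (hB : Bᵀ = B) {v : ι → K} (hv : v ⬝ᵥ B *ᵥ v ≠ 0) :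
    formReflection B v * formReflection B v = 1 := by
  refine Matrix.toLin'.injective (LinearMap.ext fun z => ?_)
  simp only [toLin'_apply, ← mulVec_mulVec, formReflection_mulVec hB, mulVec_sub, mulVec_smul,
    dotProduct_sub, dotProduct_smul, smul_eq_mul, one_mulVec]
  ext i
  simp
  field_simp
  ring

theorem formReflection_isometry (hB : Bᵀ = B) {v : ι → K} (hv : v ⬝ᵥ B *ᵥ v ≠ 0) :
    (formReflection B v)ᵀ * B * formReflection B v = B := by
  have h : (formReflection B v)ᵀ * B = B * formReflection B v := by
    rw [formReflection, transpose_sub, transpose_one, transpose_smul, transpose_vecMulVec,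
      Matrix.sub_mul, Matrix.mul_sub, Matrix.smul_mul, Matrix.mul_smul, vecMulVec_mul,
      mul_vecMulVec, Matrix.one_mul, Matrix.mul_one, ← mulVec_transpose, hB]
  rw [h, Matrix.mul_assoc, formReflection_mul_self hB hv, Matrix.mul_one]

theorem det_formReflection {v : ι → K} (hv : v ⬝ᵥ B *ᵥ v ≠ 0) :
    (formReflection B v).det = -1 := by
  have h := det_one_add_replicateCol_mul_replicateRow (ι := Unit)
    (-(2 / (v ⬝ᵥ B *ᵥ v)) • v) (B *ᵥ v)
  rw [← vecMulVec_eq, smul_vecMulVec, neg_smul, ← sub_eq_add_neg] at h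
  rw [formReflection, h, dotProduct_smul, smul_eq_mul,
    dotProduct_comm (B *ᵥ v) v, neg_mul, div_mul_cancel₀ _ hv]
  ring

theorem formReflection_mul_comm (hB : Bᵀ = B) {u : ι → K} (hu : u ⬝ᵥ B *ᵥ u ≠ 0) (v : ι → K) :
    formReflection B v * formReflection B u =
      formReflection B u * formReflection B (formReflection B u *ᵥ v) := by
  have h := mul_formReflection_of_isometry (formReflection_isometry hB hu)
    (formReflection B u *ᵥ v)
  rw [mulVec_mulVec, formReflection_mul_self hB hu, one_mulVec] at h
  exact h.symm

/-- A weak form of the Cartan–Dieudonné theorem: a form with an orthogonal basis of anisotropic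
vectors has its isometry group generated by reflections. -/
theorem mem_closure_formReflection_of_isometry [CharZero K] (hB : Bᵀ = B) {P : Matrix ι ι K}
    (hP : P.det ≠ 0) {w : ι → K} (hw : ∀ i, w i ≠ 0) (hPB : Pᵀ * B * P = diagonal w)
    {g : Matrix ι ι K} (hg : gᵀ * B * g = B) :
    g ∈ Submonoid.closure {A | ∃ v, v ⬝ᵥ B *ᵥ v ≠ 0 ∧ A = formReflection B v} := by
  have horth (i j : ι) : P.col i ⬝ᵥ B *ᵥ P.col j = diagonal w i j := by
    rw [← hPB, dotProduct_mulVec]; rfl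
  have hgen {v : ι → K} (hv : v ⬝ᵥ B *ᵥ v ≠ 0) : formReflection B v ∈
      Submonoid.closure {A | ∃ v, v ⬝ᵥ B *ᵥ v ≠ 0 ∧ A = formReflection B v} :=
    Submonoid.subset_closure ⟨v, hv, rfl⟩
  suffices ∀ s : Finset ι, ∀ g : Matrix ι ι K, gᵀ * B * g = B →
      (∀ i ∉ s, g *ᵥ P.col i = P.col i) →
      g ∈ Submonoid.closure {A | ∃ v, v ⬝ᵥ B *ᵥ v ≠ 0 ∧ A = formReflection B v} from
    this Finset.univ g hg (by simp)
  intro s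
  induction s using Finset.induction_on with
  | empty =>
    intro g _ hfix
    have h : g * P = 1 * P := by
      ext i j
      rw [Matrix.one_mul]
      exact congrFun (hfix j (by simp)) i
    have h1 : g = 1 := by
      have hu : IsUnit P := (isUnit_iff_isUnit_det P).2 hP.isUnit
      exact hu.mul_right_cancel h
    rw [h1]
    exact one_mem _
  | insert k s hk ih =>
    intro g hg hfix
    have hmul {v : ι → K} (hv : v ⬝ᵥ B *ᵥ v ≠ 0) {A : Matrix ι ι K}
        (h : formReflection B v * A ∈ Submonoid.closure
          {A | ∃ v, v ⬝ᵥ B *ᵥ v ≠ 0 ∧ A = formReflection B v}) :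
        A ∈ Submonoid.closure {A | ∃ v, v ⬝ᵥ B *ᵥ v ≠ 0 ∧ A = formReflection B v} := by
      have := mul_mem (hgen hv) h
      rwa [← Matrix.mul_assoc, formReflection_mul_self hB hv, Matrix.one_mul] at this
    have hiso {v : ι → K} (hv : v ⬝ᵥ B *ᵥ v ≠ 0) {A : Matrix ι ι K} (hA : Aᵀ * B * A = B) :
        (formReflection B v * A)ᵀ * B * (formReflection B v * A) = B := by
      have h := formReflection_isometry hB hv
      calc _ = Aᵀ * ((formReflection B v)ᵀ * B * formReflection B v) * A := by
            simp only [transpose_mul, Matrix.mul_assoc]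
        _ = B := by rw [h, hA]
    set e := P.col k
    set x := g *ᵥ e
    have he : e ⬝ᵥ B *ᵥ e ≠ 0 := by
      rw [horth]; simpa using hw k
    have hx : x ⬝ᵥ B *ᵥ x = e ⬝ᵥ B *ᵥ e := dotProduct_mulVec_mulVec_of_isometry hg e e
    have hex : e ⬝ᵥ B *ᵥ x = x ⬝ᵥ B *ᵥ e := dotProduct_mulVec_symm hB e x
    have hei (i : ι) (hi : i ∉ insert k s) : e ⬝ᵥ B *ᵥ P.col i = 0 := by
      rw [horth, diagonal_apply_ne]
      rintro rfl
      simp at hi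
    have hxi (i : ι) (hi : i ∉ insert k s) : x ⬝ᵥ B *ᵥ P.col i = 0 := by
      rw [← hfix i hi, dotProduct_mulVec_mulVec_of_isometry hg, hei i hi]
    have hfix' {A : Matrix ι ι K} (hAk : A *ᵥ e = e)
        (hA : ∀ i ∉ insert k s, A *ᵥ P.col i = P.col i) (i : ι) (hi : i ∉ s) :
        A *ᵥ P.col i = P.col i := by
      by_cases hik : i = k
      · rw [hik]; exact hAk
      · exact hA i (by simp [hik, hi])
    by_cases hm : (x - e) ⬝ᵥ B *ᵥ (x - e) = 0
    · have hp : (x + e) ⬝ᵥ B *ᵥ (x + e) ≠ 0 := by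
        intro hp
        simp only [mulVec_sub, mulVec_add, dotProduct_sub, dotProduct_add, sub_dotProduct,
          add_dotProduct, hx] at hm hp
        apply he
        linear_combination (hm + hp) / 4
      refine hmul hp (hmul he (ih _ (hiso he (hiso hp hg)) (hfix' ?_ fun i hi => ?_)))
      · have h1 : formReflection B (x + e) *ᵥ x = -e := by
          have h2 : 2 * ((x + e) ⬝ᵥ B *ᵥ x) / ((x + e) ⬝ᵥ B *ᵥ (x + e)) = 1 := by
            rw [div_eq_one_iff_eq hp]
            simp only [mulVec_add, dotProduct_add, add_dotProduct, hx, hex]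
            ring
          rw [formReflection_mulVec hB, h2, one_smul]
          abel
        rw [← mulVec_mulVec, ← mulVec_mulVec, h1, mulVec_neg, formReflection_mulVec hB,
          mul_div_assoc, div_self he]
        ext i
        simp
        ring
      · rw [← mulVec_mulVec, ← mulVec_mulVec, hfix i hi, formReflection_mulVec hB (x + e),
          add_dotProduct, hxi i hi, hei i hi]
        simp [formReflection_mulVec hB, hei i hi]
    · refine hmul hm (ih _ (hiso hm hg) (hfix' ?_ fun i hi => ?_))
      · have h2 : 2 * ((x - e) ⬝ᵥ B *ᵥ x) / ((x - e) ⬝ᵥ B *ᵥ (x - e)) = 1 := by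
          rw [div_eq_one_iff_eq hm]
          simp only [mulVec_sub, dotProduct_sub, sub_dotProduct, hx, hex]
          ring
        rw [← mulVec_mulVec, formReflection_mulVec hB (x - e)]
        change x - (2 * ((x - e) ⬝ᵥ B *ᵥ x) / _) • _ = _
        rw [h2, one_smul]
        abel
      · rw [← mulVec_mulVec, hfix i hi, formReflection_mulVec hB, sub_dotProduct, hxi i hi,
          hei i hi]
        simp

end Reflection

end Matrix

namespace MvPolynomial

/-- Clearing denominators: evaluating `p` at quotients with common denominator `q` is, up to a
power of `q`, a polynomial. -/
theorem exists_eval_eq_pow_mul_eval_div {σ τ K : Type*} [Field K] (a : σ → MvPolynomial τ K)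
    (q : MvPolynomial τ K) (p : MvPolynomial σ K) :
    ∃ (N : ℕ) (F : MvPolynomial τ K), ∀ v, eval v q ≠ 0 →
      eval v F = eval v q ^ N * eval (fun i => eval v (a i) / eval v q) p := by
  induction p using MvPolynomial.induction_on with
  | C c => exact ⟨0, C c, by simp⟩
  | add p₁ p₂ h₁ h₂ =>
    obtain ⟨N₁, F₁, h₁⟩ := h₁
    obtain ⟨N₂, F₂, h₂⟩ := h₂
    refine ⟨N₁ + N₂, q ^ N₂ * F₁ + q ^ N₁ * F₂, fun v hv => ?_⟩
    simp only [map_add, map_mul, map_pow, h₁ v hv, h₂ v hv]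
    ring
  | mul_X p i h =>
    obtain ⟨N, F, h⟩ := h
    refine ⟨N + 1, F * a i, fun v hv => ?_⟩
    simp only [map_mul, h v hv, eval_X]
    field_simp
    ring

theorem eval_eq_zero_of_infinite_line {τ K : Type*} [Field K] (F : MvPolynomial τ K)
    (x y : τ → K) (h : {t : K | eval (x + t • y) F = 0}.Infinite) : eval x F = 0 := by
  let f : Polynomial K := aeval (fun i => Polynomial.C (x i) + Polynomial.X * Polynomial.C (y i)) F
  have hf (t : K) : f.eval t = eval (x + t • y) F := by
    have h : (Polynomial.evalRingHom t).comp (aeval (R := K)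
        fun i => Polynomial.C (x i) + Polynomial.X * Polynomial.C (y i)).toRingHom =
        eval (x + t • y) := by
      refine ringHom_ext (fun r => ?_) fun i => ?_ <;> simp [mul_comm t]
    exact congrFun (congrArg DFunLike.coe h) F
  have h0 : f = 0 := Polynomial.eq_zero_of_infinite_isRoot f
    (by simpa [Polynomial.IsRoot, hf] using h)
  have := hf 0
  rw [h0] at this
  simpa using this.symm

end MvPolynomial

section ZariskiClosure

variable {ι K : Type*} [Field K]

/-- The Zariski closure of a set of square matrices. -/
def zariskiClosure (S : Set (Matrix ι ι K)) : Set (Matrix ι ι K) :=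
  {g | ∀ p : MvPolynomial (ι × ι) K, (∀ d ∈ S, p.eval (fun ij => d ij.1 ij.2) = 0) →
    p.eval (fun ij => g ij.1 ij.2) = 0}

theorem subset_zariskiClosure (S : Set (Matrix ι ι K)) : S ⊆ zariskiClosure S :=
  fun _ hd _ hp => hp _ hd

theorem exists_eval_mul [Fintype ι] (p : MvPolynomial (ι × ι) K) (a b : Matrix ι ι K) :
    ∃ p' : MvPolynomial (ι × ι) K, ∀ g : Matrix ι ι K,
      p'.eval (fun ij => g ij.1 ij.2) = p.eval (fun ij => (a * g * b) ij.1 ij.2) := by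
  refine ⟨MvPolynomial.bind₁ (fun ij => ∑ l, ∑ k, MvPolynomial.C (a ij.1 k) *
    MvPolynomial.X (k, l) * MvPolynomial.C (b l ij.2)) p, fun g => ?_⟩
  change MvPolynomial.eval₂Hom _ _ _ = _
  rw [MvPolynomial.eval₂Hom_bind₁]
  change MvPolynomial.eval _ p = _
  congr 2
  ext ij
  simp [Matrix.mul_apply, Finset.sum_mul, MvPolynomial.eval₂Hom]

theorem mul_mem_zariskiClosure [Fintype ι] [DecidableEq ι] {S : Set (Matrix ι ι K)}
    (hS : ∀ g ∈ S, ∀ h ∈ S, g * h ∈ S) {g h : Matrix ι ι K}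
    (hg : g ∈ zariskiClosure S) (hh : h ∈ zariskiClosure S) : g * h ∈ zariskiClosure S := by
  have hd : ∀ d ∈ S, d * h ∈ zariskiClosure S := by
    intro d hd p hp
    obtain ⟨p', hp'⟩ := exists_eval_mul p d 1
    simp only [Matrix.mul_one] at hp'
    rw [← hp']
    exact hh p' fun e he => by rw [hp']; exact hp _ (hS d hd e he)
  intro p hp
  obtain ⟨p', hp'⟩ := exists_eval_mul p 1 h
  simp only [Matrix.one_mul] at hp'
  rw [← hp']
  exact hg p' fun d hd' => by rw [hp']; exact hd d hd' p hp

end ZariskiClosure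

section PolynomialReflection

variable {ι K : Type*} [Fintype ι] [DecidableEq ι] [Field K] {B : Matrix ι ι K}

theorem exists_eval_eq_zero_iff_reflection (B A : Matrix ι ι K) (p : MvPolynomial (ι × ι) K) :
    ∃ F : MvPolynomial ι K, ∀ v : ι → K, v ⬝ᵥ B *ᵥ v ≠ 0 → (F.eval v = 0 ↔
      p.eval (fun ij => (A * formReflection B v) ij.1 ij.2) = 0) := by
  obtain ⟨p', hp'⟩ := exists_eval_mul p A 1
  let lin : ι → MvPolynomial ι K := fun i => ∑ j, MvPolynomial.C (B i j) * MvPolynomial.X j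
  have hlin (v : ι → K) (i : ι) : (lin i).eval v = (B *ᵥ v) i := by
    simp [lin, mulVec, dotProduct]
  let q : MvPolynomial ι K := ∑ i, MvPolynomial.X i * lin i
  have hq (v : ι → K) : q.eval v = v ⬝ᵥ B *ᵥ v := by
    simp [q, hlin, dotProduct]
  let a : ι × ι → MvPolynomial ι K := fun ij =>
    MvPolynomial.C ((1 : Matrix ι ι K) ij.1 ij.2) * q - 2 * MvPolynomial.X ij.1 * lin ij.2
  obtain ⟨N, F, hF⟩ := MvPolynomial.exists_eval_eq_pow_mul_eval_div a q p'
  refine ⟨F, fun v hv => ?_⟩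
  have h : (fun i => (a i).eval v / q.eval v) = fun ij => formReflection B v ij.1 ij.2 := by
    ext ij
    simp only [a, map_sub, map_mul, MvPolynomial.eval_C, MvPolynomial.eval_X, hlin, hq,
      formReflection, Matrix.sub_apply, Matrix.smul_apply, vecMulVec_apply, smul_eq_mul, map_ofNat]
    field_simp
  rw [hF v (by rwa [hq]), h, hp', Matrix.mul_one, hq, mul_eq_zero]
  simp [hv]

end PolynomialReflection

section PellIsometry

variable {ι R : Type*} [Fintype ι] [CommRing R] {B : Matrix ι ι R}

/-- The infinitesimal rotation `z ↦ b(v, z) u - b(u, z) v` in the plane spanned by `u` and `v`. -/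
def planeRotation (B : Matrix ι ι R) (u v : ι → R) : Matrix ι ι R :=
  vecMulVec u (B *ᵥ v) - vecMulVec v (B *ᵥ u)

/-- Minus the Gram determinant of `u` and `v`. -/
def negGram (B : Matrix ι ι R) (u v : ι → R) : R :=
  (u ⬝ᵥ B *ᵥ v) ^ 2 - (u ⬝ᵥ B *ᵥ u) * (v ⬝ᵥ B *ᵥ v)

/-- If `x ^ 2 - d * y ^ 2 = 1` with `d = negGram B u v`, this is the isometry acting on the plane
spanned by `u` and `v` as multiplication by `(x + y √d) ^ 2`, and trivially on its orthogonal
complement. -/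
def pellIsometry [DecidableEq ι] (B : Matrix ι ι R) (u v : ι → R) (x y : R) : Matrix ι ι R :=
  1 + (2 * x * y) • planeRotation B u v +
    (2 * y ^ 2) • (planeRotation B u v * planeRotation B u v)

theorem negGram_add_smul (hB : Bᵀ = B)
    (u v w : ι → R) (s : R) : negGram B u (v + s • w) = negGram B u w * s ^ 2 +
      2 * ((u ⬝ᵥ B *ᵥ v) * (u ⬝ᵥ B *ᵥ w) - (u ⬝ᵥ B *ᵥ u) * (v ⬝ᵥ B *ᵥ w)) * s +
      negGram B u v := by
  simp only [negGram, mulVec_add, mulVec_smul, dotProduct_add, dotProduct_smul, add_dotProduct,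
    smul_dotProduct, smul_eq_mul, dotProduct_mulVec_symm hB w v]
  ring

theorem dotProduct_mulVec_self_ne_zero_of_negGram {u v : ι → R}
    (h : ¬ IsSquare (negGram B u v)) : v ⬝ᵥ B *ᵥ v ≠ 0 := by
  intro hv
  exact h ⟨u ⬝ᵥ B *ᵥ v, by rw [negGram, hv]; ring⟩

theorem map_dotProduct_mulVec {S : Type*} [CommRing S] (f : R →+* S)
    (B : Matrix ι ι R) (u v : ι → R) :
    (f ∘ u) ⬝ᵥ B.map f *ᵥ (f ∘ v) = f (u ⬝ᵥ B *ᵥ v) := by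
  simp [RingHom.map_dotProduct, RingHom.map_mulVec, Function.comp_def]

theorem planeRotation_mulVec (hB : Bᵀ = B) (u v z : ι → R) :
    planeRotation B u v *ᵥ z = (v ⬝ᵥ B *ᵥ z) • u - (u ⬝ᵥ B *ᵥ z) • v := by
  rw [planeRotation, sub_mulVec, vecMulVec_mulVec, vecMulVec_mulVec, dotProduct_comm (B *ᵥ v),
    dotProduct_comm (B *ᵥ u), dotProduct_mulVec_symm hB z, dotProduct_mulVec_symm hB z]
  simp

theorem planeRotation_pow_three [DecidableEq ι] (hB : Bᵀ = B) (u v : ι → R) :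
    planeRotation B u v * (planeRotation B u v * planeRotation B u v) =
      negGram B u v • planeRotation B u v := by
  refine Matrix.toLin'.injective (LinearMap.ext fun z => ?_)
  simp only [toLin'_apply, ← mulVec_mulVec, smul_mulVec, planeRotation_mulVec hB, mulVec_sub,
    mulVec_smul, dotProduct_sub, dotProduct_smul, smul_eq_mul, negGram,
    dotProduct_mulVec_symm hB v u]
  module

theorem pellIsometry_mul [DecidableEq ι] (hB : Bᵀ = B) (u v : ι → R) {x₁ y₁ x₂ y₂ : R}
    (h₁ : x₁ ^ 2 - negGram B u v * y₁ ^ 2 = 1) (h₂ : x₂ ^ 2 - negGram B u v * y₂ ^ 2 = 1) :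
    pellIsometry B u v x₁ y₁ * pellIsometry B u v x₂ y₂ =
      pellIsometry B u v (x₁ * x₂ + negGram B u v * (y₁ * y₂)) (x₁ * y₂ + y₁ * x₂) := by
  have h := planeRotation_pow_three hB u v
  simp only [pellIsometry, Matrix.add_mul, Matrix.mul_add, Matrix.mul_one, Matrix.one_mul,
    Matrix.smul_mul, Matrix.mul_smul, Matrix.mul_assoc, h, smul_smul]
  match_scalars
  · ring
  · linear_combination (-2 * x₂ * y₂) * h₁ + (-2 * x₁ * y₁) * h₂
  · linear_combination (-2 * y₂ ^ 2) * h₁ + (-2 * y₁ ^ 2) * h₂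

theorem pellIsometry_eq_mul_formReflection {K : Type*} [Field K] [DecidableEq ι]
    {B : Matrix ι ι K} (hB : Bᵀ = B) {u v : ι → K} (hu : u ⬝ᵥ B *ᵥ u ≠ 0) {x y : K}
    (h : x ^ 2 - negGram B u v * y ^ 2 = 1) {w : ι → K}
    (hw : w = (x - y * (u ⬝ᵥ B *ᵥ v)) • u + (y * (u ⬝ᵥ B *ᵥ u)) • v) :
    w ⬝ᵥ B *ᵥ w = u ⬝ᵥ B *ᵥ u ∧
    pellIsometry B u v x y = formReflection B u * formReflection B w := by
  have hvu := dotProduct_mulVec_symm hB v u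
  have hww : w ⬝ᵥ B *ᵥ w = u ⬝ᵥ B *ᵥ u := by
    rw [hw]
    simp only [mulVec_add, mulVec_smul, dotProduct_add, dotProduct_smul, add_dotProduct,
      smul_dotProduct, smul_eq_mul, hvu]
    rw [negGram] at h
    linear_combination (u ⬝ᵥ B *ᵥ u) * h
  refine ⟨hww, Matrix.toLin'.injective (LinearMap.ext fun z => ?_)⟩
  simp only [toLin'_apply, ← mulVec_mulVec, formReflection_mulVec hB, hww, pellIsometry,
    add_mulVec, smul_mulVec, one_mulVec, planeRotation_mulVec hB, mulVec_sub, mulVec_smul,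
    dotProduct_sub, dotProduct_smul]
  rw [hw]
  simp only [mulVec_add, mulVec_smul, dotProduct_add, dotProduct_smul, add_dotProduct,
      smul_dotProduct, smul_eq_mul, hvu]
  rw [negGram] at h
  generalize u ⬝ᵥ B *ᵥ u = a at *
  generalize u ⬝ᵥ B *ᵥ v = b at *
  generalize v ⬝ᵥ B *ᵥ v = c at *
  generalize u ⬝ᵥ B *ᵥ z = p at *
  generalize v ⬝ᵥ B *ᵥ z = q at *
  match_scalars
  · ring
  · field_simp
    linear_combination (-2 * p) * h
  · field_simp
    ring

theorem negGram_map {S : Type*} [CommRing S] (f : R →+* S) (B : Matrix ι ι R) (u v : ι → R) :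
    negGram (B.map f) (f ∘ u) (f ∘ v) = f (negGram B u v) := by
  simp [negGram, RingHom.map_dotProduct, RingHom.map_mulVec, Function.comp_def]

theorem pellIsometry_map [DecidableEq ι] {S : Type*} [CommRing S] (f : R →+* S)
    (B : Matrix ι ι R) (u v : ι → R) (x y : R) :
    (pellIsometry B u v x y).map f =
      pellIsometry (B.map f) (f ∘ u) (f ∘ v) (f x) (f y) := by
  have h : (planeRotation B u v).map f = planeRotation (B.map f) (f ∘ u) (f ∘ v) := by
    ext i j
    simp [planeRotation, vecMulVec_apply, RingHom.map_mulVec]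
  have h1 : f.mapMatrix (pellIsometry B u v x y) =
      pellIsometry (B.map f) (f ∘ u) (f ∘ v) (f x) (f y) := by
    rw [pellIsometry, pellIsometry, ← h]
    ext i j
    simp [Matrix.map_apply, Matrix.mul_apply, Matrix.one_apply, apply_ite f, map_ofNat f 2]
  exact h1

end PellIsometry

section Integral

theorem exists_pow_mem_of_finite_cosets {ι : Type*} [Fintype ι] [DecidableEq ι]
    {D : Set (Matrix ι ι ℤ)} (hD_mul : ∀ g ∈ D, ∀ h ∈ D, g * h ∈ D)
    (hD_inv : ∀ g ∈ D, ∃ h ∈ D, g * h = 1 ∧ h * g = 1) (T : Finset (Matrix ι ι ℤ))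
    {γ : Matrix ι ι ℤ} (hγ : γ.det = 1) (hT : ∀ n : ℕ, ∃ t ∈ T, ∃ d ∈ D, γ ^ n = t * d) :
    ∃ k, 0 < k ∧ γ ^ k ∈ D := by
  choose t ht d hd htd using hT
  obtain ⟨i, j, hij, heq⟩ : ∃ i j, i < j ∧ t i = t j := by
    obtain ⟨i, j, hij, heq⟩ := Finite.exists_ne_map_eq_of_infinite
      (fun n : ℕ => (⟨t n, ht n⟩ : T))
    rw [Subtype.mk.injEq] at heq
    rcases hij.lt_or_gt with h | h
    exacts [⟨i, j, h, heq⟩, ⟨j, i, h, heq.symm⟩]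
  refine ⟨j - i, by omega, ?_⟩
  obtain ⟨e, he, -, hed⟩ := hD_inv (d i) (hd i)
  have hunit : IsUnit (t i) := by
    rw [isUnit_iff_isUnit_det]
    have h := congrArg det (htd i)
    rw [det_pow, hγ, one_pow, det_mul] at h
    exact IsUnit.of_mul_eq_one _ h.symm
  have h : d i * γ ^ (j - i) = d j := by
    apply hunit.mul_left_cancel
    rw [← Matrix.mul_assoc, ← htd i, ← pow_add, heq, ← htd j]
    congr 1
    omega
  have h' : γ ^ (j - i) = e * d j := by
    rw [← h, ← Matrix.mul_assoc, hed, Matrix.one_mul]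
  rw [h']
  exact hD_mul e he _ (hd j)

theorem exists_int_dotProduct_mulVec_neg {ι : Type*} [Fintype ι] (M : Matrix ι ι ℤ) {x : ι → ℝ}
    (hx : x ⬝ᵥ M.map (fun a : ℤ => (a : ℝ)) *ᵥ x < 0) : ∃ z : ι → ℤ, z ⬝ᵥ M *ᵥ z < 0 := by
  have hcont : Continuous fun y : ι → ℝ => y ⬝ᵥ M.map (fun a : ℤ => (a : ℝ)) *ᵥ y := by
    simp only [dotProduct, mulVec]
    fun_prop
  obtain ⟨y, hy⟩ := (DenseRange.piMap (fun _ : ι => Rat.denseRange_cast (𝕜 := ℝ))).exists_mem_open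
    (isOpen_Iio.preimage hcont) ⟨x, hx⟩
  obtain ⟨N, hN⟩ := IsLocalization.exist_integer_multiples_of_finite (nonZeroDivisors ℤ) y
  choose z hz using hN
  refine ⟨z, ?_⟩
  have hN0 : ((N : ℤ) : ℝ) ≠ 0 := by exact_mod_cast nonZeroDivisors.ne_zero N.2
  have hzy : (fun i => (z i : ℝ)) = ((N : ℤ) : ℝ) • Pi.map (fun _ (q : ℚ) => (q : ℝ)) y := by
    ext i
    have h := congrArg (fun q : ℚ => (q : ℝ)) (hz i)
    simpa using h
  have hcast : ((z ⬝ᵥ M *ᵥ z : ℤ) : ℝ) =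
      (fun i => (z i : ℝ)) ⬝ᵥ M.map (fun a : ℤ => (a : ℝ)) *ᵥ fun i => (z i : ℝ) := by
    simp [dotProduct, mulVec]
  have hneg : ((z ⬝ᵥ M *ᵥ z : ℤ) : ℝ) < 0 := by
    rw [hcast, hzy, mulVec_smul, dotProduct_smul, smul_dotProduct, smul_eq_mul, smul_eq_mul,
      ← mul_assoc]
    exact mul_neg_of_pos_of_neg (mul_self_pos.2 hN0) hy
  exact_mod_cast hneg

/-- A quadratic polynomial with positive discriminant is positive far from its roots, and it is
not a square there if its leading coefficient is. -/
theorem pos_and_not_isSquare_of_quadratic {α β γ s : ℤ} (hα : 0 < α) (hΔ : 0 < β ^ 2 - α * γ)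
    (hs : |β| + (β ^ 2 - α * γ) < s) :
    0 < α * s ^ 2 + 2 * β * s + γ ∧
      (IsSquare α → ¬ IsSquare (α * s ^ 2 + 2 * β * s + γ)) := by
  have hβ := neg_abs_le β
  have hβ' := abs_nonneg β
  set Δ := β ^ 2 - α * γ with hΔdef
  have hX : Δ < α * s + β := by nlinarith
  have hid : α * (α * s ^ 2 + 2 * β * s + γ) = (α * s + β) ^ 2 - Δ := by rw [hΔdef]; ring
  refine ⟨?_, ?_⟩
  · have : 0 < α * (α * s ^ 2 + 2 * β * s + γ) := by rw [hid]; nlinarith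
    exact pos_of_mul_pos_right this hα.le
  · rintro ⟨c, hc⟩ ⟨y, hy⟩
    have h : |c * y| ^ 2 = (α * s + β) ^ 2 - Δ := by
      rw [sq_abs, ← hid, hy]
      nth_rewrite 1 [hc]
      ring
    have h0 := abs_nonneg (c * y)
    have hlt : |c * y| < α * s + β := by
      by_contra! hle
      nlinarith
    nlinarith

theorem strictMono_pell_y_pow {d : ℤ} {a : Pell.Solution₁ d} (hx : 0 < a.x)
    (hy : 0 < a.y) : StrictMono fun n : ℕ => (a ^ n).y := by
  refine strictMono_nat_of_lt_succ fun n => ?_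
  have h1 := Pell.Solution₁.x_pow_pos hx n
  have h0 : 0 ≤ (a ^ n).y := by
    cases n with
    | zero => simp
    | succ n => exact (Pell.Solution₁.y_pow_succ_pos hx hy n).le
  rw [pow_succ, Pell.Solution₁.y_mul]
  nlinarith

end Integral

section Density

variable {ι : Type*} [Fintype ι] [DecidableEq ι]

theorem formReflection_smul {K : Type*} [Field K] (B : Matrix ι ι K) {c : K} (hc : c ≠ 0)
    (v : ι → K) : formReflection B (c • v) = formReflection B v := by
  rw [formReflection, formReflection]
  simp only [mulVec_smul, dotProduct_smul, smul_dotProduct, smul_vecMulVec, vecMulVec_smul,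
    smul_smul, smul_eq_mul]
  congr 2
  by_cases hv : v ⬝ᵥ B *ᵥ v = 0
  · simp [hv]
  · field_simp

theorem eval_eq_zero_of_int_line {τ K : Type*} [Field K] [CharZero K] (F : MvPolynomial τ K)
    (x y : τ → K) (N : ℤ) (h : ∀ s : ℤ, N < s → F.eval (x + (s : K) • y) = 0) :
    F.eval x = 0 := by
  refine F.eval_eq_zero_of_infinite_line x y (Set.infinite_of_injective_forall_mem
    (f := fun n : ℕ => ((N + 1 + n : ℤ) : K)) (fun m n hmn => ?_) fun n => h _ (by omega))
  have := Int.cast_injective hmn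
  omega

theorem mul_formReflection_mem_of_not_isSquare {K : Type*} [Field K] [CharZero K]
    {B : Matrix ι ι ℤ} (hB : Bᵀ = B) {D : Set (Matrix ι ι ℤ)} (hD_one : 1 ∈ D)
    (hD_mul : ∀ g ∈ D, ∀ h ∈ D, g * h ∈ D)
    (hD_pow : ∀ γ : Matrix ι ι ℤ, γᵀ * B * γ = B → γ.det = 1 → ∃ k, 0 < k ∧ γ ^ k ∈ D)
    {u v : ι → ℤ} (hu : u ⬝ᵥ B *ᵥ u ≠ 0) (hpos : 0 < negGram B u v)
    (hsq : ¬ IsSquare (negGram B u v)) :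
    formReflection (B.map (Int.castRingHom K)) (Int.castRingHom K ∘ u) *
      formReflection (B.map (Int.castRingHom K)) (Int.castRingHom K ∘ v) ∈
      zariskiClosure ((fun d => d.map (Int.castRingHom K)) '' D) := by
  set f := Int.castRingHom K
  have hinj : Function.Injective f := Int.cast_injective
  set BK := B.map f with hBK
  have hBKs : BKᵀ = BK := by rw [hBK, ← transpose_map, hB]
  set U := f ∘ u
  set V := f ∘ v
  let δ (a : Pell.Solution₁ (negGram B u v)) : Matrix ι ι ℤ := pellIsometry B u v a.x a.y
  have hδmul (a b) : δ (a * b) = δ a * δ b := by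
    simp only [δ]
    rw [pellIsometry_mul hB u v a.prop b.prop, Pell.Solution₁.x_mul, Pell.Solution₁.y_mul]
  have hδpow (a) (n : ℕ) : δ (a ^ n) = δ a ^ n := by
    induction n with
    | zero => simp [δ, pellIsometry]
    | succ n ih => rw [pow_succ, pow_succ, hδmul, ih]
  have hUU : U ⬝ᵥ BK *ᵥ U = f (u ⬝ᵥ B *ᵥ u) := map_dotProduct_mulVec f B u u
  have hU : U ⬝ᵥ BK *ᵥ U ≠ 0 := by
    rw [hUU]
    exact (map_ne_zero_iff f hinj).2 hu
  let w (a : Pell.Solution₁ (negGram B u v)) : ι → K :=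
    (f a.x - f a.y * (U ⬝ᵥ BK *ᵥ V)) • U + (f a.y * (U ⬝ᵥ BK *ᵥ U)) • V
  have hδ (a) : w a ⬝ᵥ BK *ᵥ w a = U ⬝ᵥ BK *ᵥ U ∧
      (δ a).map f = formReflection BK U * formReflection BK (w a) := by
    rw [pellIsometry_map]
    refine pellIsometry_eq_mul_formReflection hBKs hU ?_ rfl
    rw [negGram_map, ← map_pow, ← map_pow, ← map_mul, ← map_sub, a.prop, map_one]
  have hw (a) : w a ⬝ᵥ BK *ᵥ w a ≠ 0 := by rw [(hδ a).1]; exact hU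
  have hiso (a) : (δ a)ᵀ * B * δ a = B := by
    refine Matrix.map_injective hinj ?_
    change ((δ a)ᵀ * B * δ a).map f = B.map f
    rw [Matrix.map_mul, Matrix.map_mul, transpose_map, (hδ a).2, transpose_mul]
    calc _ = (formReflection BK (w a))ᵀ * ((formReflection BK U)ᵀ * BK * formReflection BK U) *
          formReflection BK (w a) := by simp only [Matrix.mul_assoc, hBK]
      _ = BK := by
        rw [formReflection_isometry hBKs hU, formReflection_isometry hBKs (hw a)]
  have hdet (a) : (δ a).det = 1 := by
    apply hinj
    rw [RingHom.map_det]
    change ((δ a).map f).det = _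
    rw [(hδ a).2, det_mul, det_formReflection hU, det_formReflection (hw a)]
    simp
  obtain ⟨a, hax, hay⟩ := Pell.Solution₁.exists_pos_of_not_isSquare hpos hsq
  obtain ⟨k, hk, hkD⟩ := hD_pow (δ a) (hiso a) (hdet a)
  have hD (m : ℕ) : δ (a ^ (k * m)) ∈ D := by
    rw [hδpow, pow_mul]
    induction m with
    | zero => simpa using hD_one
    | succ m ih => rw [pow_succ]; exact hD_mul _ ih _ hkD
  intro p hp
  obtain ⟨F, hF⟩ := exists_eval_eq_zero_iff_reflection BK (formReflection BK U) p
  have hV : V ⬝ᵥ BK *ᵥ V ≠ 0 := by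
    rw [map_dotProduct_mulVec]
    exact (map_ne_zero_iff f hinj).2 (dotProduct_mulVec_self_ne_zero_of_negGram hsq)
  refine (hF V hV).1 ?_
  let c (m : ℕ) := a ^ (k * (m + 1))
  have hmono := strictMono_pell_y_pow (by omega : 0 < a.x) hay
  have hcy (m : ℕ) : 0 < (c m).y := by
    have := hmono (show 0 < k * (m + 1) by positivity)
    simpa using this
  have hcyK (m : ℕ) : f (c m).y ≠ 0 := (map_ne_zero_iff f hinj).2 (hcy m).ne'
  refine F.eval_eq_zero_of_infinite_line V U (Set.infinite_of_injective_forall_mem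
    (f := fun m : ℕ => (f (c m).x - f (c m).y * (U ⬝ᵥ BK *ᵥ V)) /
      (f (c m).y * (U ⬝ᵥ BK *ᵥ U))) (fun m n hmn => ?_) fun m => ?_)
  · have h1 : (c m).x * (c n).y = (c n).x * (c m).y := by
      apply hinj
      have hm := hcyK m
      have hn := hcyK n
      simp only at hmn
      field_simp at hmn
      simp only [map_mul]
      linear_combination hmn
    have h2 : (c m).y ^ 2 = (c n).y ^ 2 := by
      have := congrArg (· ^ 2) h1
      simp only [mul_pow, Pell.Solution₁.prop_x] at this
      linear_combination -this
    have h3 : (c m).y = (c n).y := by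
      rwa [sq_eq_sq₀ (hcy m).le (hcy n).le] at h2
    have h4 := hmono.injective h3
    have := Nat.eq_of_mul_eq_mul_left hk h4
    omega
  · have hne : f (c m).y * (U ⬝ᵥ BK *ᵥ U) ≠ 0 := mul_ne_zero (hcyK m) hU
    have hwm : w (c m) = (f (c m).y * (U ⬝ᵥ BK *ᵥ U)) •
        (V + ((f (c m).x - f (c m).y * (U ⬝ᵥ BK *ᵥ V)) /
          (f (c m).y * (U ⬝ᵥ BK *ᵥ U))) • U) := by
      rw [smul_add, smul_smul, mul_div_cancel₀ _ hne, add_comm]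
    have hq := hw (c m)
    have hR := (hδ (c m)).2
    rw [hwm] at hq hR
    rw [formReflection_smul _ hne] at hR
    rw [mulVec_smul, dotProduct_smul, smul_dotProduct, smul_smul, smul_eq_mul] at hq
    refine (hF _ (right_ne_zero_of_mul hq)).2 ?_
    rw [← hR]
    exact hp _ ⟨_, hD (m + 1), rfl⟩

theorem mul_formReflection_mem_of_indefinite {K : Type*} [Field K] [CharZero K]
    {B : Matrix ι ι ℤ} (hB : Bᵀ = B) {u : ι → ℤ} (hpos : ∃ v, 0 < negGram B u v)
    (hneg : ∃ v, negGram B u v < 0) {A : Matrix ι ι K} {S : Set (Matrix ι ι K)}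
    (h : ∀ v : ι → ℤ, 0 < negGram B u v → ¬ IsSquare (negGram B u v) →
      A * formReflection (B.map (Int.castRingHom K)) (Int.castRingHom K ∘ v) ∈ zariskiClosure S)
    {v : ι → K} (hv : v ⬝ᵥ B.map (Int.castRingHom K) *ᵥ v ≠ 0) :
    A * formReflection (B.map (Int.castRingHom K)) v ∈ zariskiClosure S := by
  intro p hp
  obtain ⟨F, hF⟩ := exists_eval_eq_zero_iff_reflection (B.map (Int.castRingHom K)) A p
  refine (hF v hv).1 ?_
  have hcast (z y : ι → ℤ) (s : ℤ) : Int.castRingHom K ∘ (z + s • y) =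
      Int.castRingHom K ∘ z + (s : K) • (Int.castRingHom K ∘ y) := by
    ext i
    simp
  have hsquare {z : ι → ℤ} (h1 : 0 < negGram B u z) (h2 : ¬ IsSquare (negGram B u z)) :
      F.eval (Int.castRingHom K ∘ z) = 0 := by
    refine (hF _ ?_).2 (h z h1 h2 p hp)
    rw [map_dotProduct_mulVec]
    exact (map_ne_zero_iff _ Int.cast_injective).2 (dotProduct_mulVec_self_ne_zero_of_negGram h2)
  obtain ⟨y, hy, hy'⟩ : ∃ y, 0 < negGram B u y ∧ (IsSquare (negGram B u y) ∨
      ∀ z, 0 < negGram B u z → ¬ IsSquare (negGram B u z)) := by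
    by_cases hex : ∃ y, 0 < negGram B u y ∧ IsSquare (negGram B u y)
    · obtain ⟨y, hy, hy'⟩ := hex
      exact ⟨y, hy, Or.inl hy'⟩
    · obtain ⟨y, hy⟩ := hpos
      push Not at hex
      exact ⟨y, hy, Or.inr hex⟩
  have hnegative {z : ι → ℤ} (hz : negGram B u z < 0) : F.eval (Int.castRingHom K ∘ z) = 0 := by
    set β := (u ⬝ᵥ B *ᵥ z) * (u ⬝ᵥ B *ᵥ y) - (u ⬝ᵥ B *ᵥ u) * (z ⬝ᵥ B *ᵥ y) with hβ
    refine eval_eq_zero_of_int_line F _ (Int.castRingHom K ∘ y)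
      (|β| + (β ^ 2 - negGram B u y * negGram B u z)) fun s hs => ?_
    obtain ⟨h1, h2⟩ := pos_and_not_isSquare_of_quadratic hy (by nlinarith [sq_nonneg β]) hs
    rw [hβ, ← negGram_add_smul hB] at h1 h2
    rw [← hcast]
    exact hsquare h1 (hy'.elim h2 fun h => h _ h1)
  have hint (z : ι → ℤ) : F.eval (Int.castRingHom K ∘ z) = 0 := by
    obtain ⟨x, hx⟩ := hneg
    set β := (u ⬝ᵥ B *ᵥ z) * (u ⬝ᵥ B *ᵥ x) - (u ⬝ᵥ B *ᵥ u) * (z ⬝ᵥ B *ᵥ x) with hβ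
    refine eval_eq_zero_of_int_line F _ (Int.castRingHom K ∘ x)
      (2 * |β| + |negGram B u z|) fun s hs => ?_
    rw [← hcast]
    apply hnegative
    rw [negGram_add_smul hB, ← hβ]
    have h1 := le_abs_self β
    have h2 := le_abs_self (negGram B u z)
    have h3 := abs_nonneg β
    have h4 := abs_nonneg (negGram B u z)
    nlinarith [mul_le_mul_of_nonneg_right h1 (by omega : 0 ≤ s),
      mul_le_mul_of_nonneg_right (by omega : negGram B u x ≤ -1) (sq_nonneg s)]
  have hF0 : F = 0 := by
    refine MvPolynomial.funext_set (fun _ => Set.range (Int.cast : ℤ → K))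
      (fun _ => Set.infinite_range_of_injective Int.cast_injective) fun x hx => ?_
    choose z hz using fun i => hx i trivial
    have hxz : x = Int.castRingHom K ∘ z := funext fun i => (hz i).symm
    rw [hxz, hint, map_zero]
  rw [hF0, map_zero]

/-- A multiplicatively closed set containing all `τ_u τ_v` for a fixed anisotropic
vector `u` contains the special orthogonal group. -/
theorem mem_of_forall_mul_formReflection_mem {K : Type*} [Field K] [CharZero K]
    {B : Matrix ι ι K} (hB : Bᵀ = B) {P : Matrix ι ι K} (hP : P.det ≠ 0) {w : ι → K}
    (hw : ∀ i, w i ≠ 0) (hPB : Pᵀ * B * P = diagonal w) {H : Set (Matrix ι ι K)}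
    (hH_one : 1 ∈ H) (hH_mul : ∀ g ∈ H, ∀ h ∈ H, g * h ∈ H) {u : ι → K}
    (hu : u ⬝ᵥ B *ᵥ u ≠ 0)
    (hH : ∀ v, v ⬝ᵥ B *ᵥ v ≠ 0 → formReflection B u * formReflection B v ∈ H)
    {g : Matrix ι ι K} (hg : gᵀ * B * g = B) (hdet : g.det = 1) : g ∈ H := by
  have key : g.det = 1 ∧ g ∈ H ∨ g.det = -1 ∧ formReflection B u * g ∈ H := by
    clear hdet
    have hmem := mem_closure_formReflection_of_isometry hB hP hw hPB hg
    clear hg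
    induction hmem using Submonoid.closure_induction_left with
    | one => exact Or.inl ⟨det_one, hH_one⟩
    | mul_left A hA g _ ih =>
      obtain ⟨v, hv, rfl⟩ := hA
      rcases ih with ⟨h1, h2⟩ | ⟨h1, h2⟩
      · right
        rw [det_mul, h1, det_formReflection hv, ← Matrix.mul_assoc]
        exact ⟨by simp, hH_mul _ (hH v hv) _ h2⟩
      · left
        rw [det_mul, h1, det_formReflection hv]
        refine ⟨by simp, ?_⟩
        have h3 : formReflection B v * g =
            formReflection B u * formReflection B (formReflection B u *ᵥ v) *
              (formReflection B u * g) := by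
          rw [← formReflection_mul_comm hB hu, Matrix.mul_assoc, ← Matrix.mul_assoc _ _ g,
            formReflection_mul_self hB hu, Matrix.one_mul]
        rw [h3]
        refine hH_mul _ (hH _ ?_) _ h2
        rwa [dotProduct_mulVec_mulVec_of_isometry (formReflection_isometry hB hu)]
  rcases key with ⟨-, h⟩ | ⟨h, -⟩
  · exact h
  · rw [hdet] at h
    norm_num at h

end Density

section Signature

theorem col_dotProduct_mulVec_col {ι R : Type*} [Fintype ι] [CommRing R] (A P : Matrix ι ι R)
    (i j : ι) : P.col i ⬝ᵥ A *ᵥ P.col j = (Pᵀ * A * P) i j := by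
  rw [dotProduct_mulVec]
  rfl

/-- The Gram matrix of the quadratic form `negGram B u`. -/
def negGramMatrix {ι R : Type*} [Fintype ι] [CommRing R] (B : Matrix ι ι R) (u : ι → R) :
    Matrix ι ι R :=
  vecMulVec (u ᵥ* B) (u ᵥ* B) - (u ⬝ᵥ B *ᵥ u) • B

theorem dotProduct_negGramMatrix_mulVec {ι R : Type*} [Fintype ι] [CommRing R]
    (B : Matrix ι ι R) (u z : ι → R) : z ⬝ᵥ negGramMatrix B u *ᵥ z = negGram B u z := by
  simp only [negGramMatrix, negGram, sub_mulVec, dotProduct_sub, vecMulVec_mulVec, smul_mulVec,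
    dotProduct_smul, smul_eq_mul, dotProduct_mulVec u B z]
  rw [dotProduct_comm z, op_smul_eq_smul, smul_eq_mul]
  ring

theorem negGramMatrix_map {ι R S : Type*} [Fintype ι] [CommRing R] [CommRing S] (f : R →+* S)
    (B : Matrix ι ι R) (u : ι → R) :
    (negGramMatrix B u).map f = negGramMatrix (B.map f) (f ∘ u) := by
  ext k l
  simp [negGramMatrix, vecMulVec_apply, RingHom.map_vecMul, map_dotProduct_mulVec]

/-- If the form is negative definite on a plane and `u` is a negative vector, then some vector
spans a definite plane together with `u`. -/
theorem exists_negGram_neg {ι : Type*} [Fintype ι] [DecidableEq ι] {B : Matrix ι ι ℤ} {u : ι → ℤ}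
    (hu : u ⬝ᵥ B *ᵥ u < 0) {P : Matrix ι ι ℝ} {w : ι → ℝ} {i j : ι} (hij : i ≠ j)
    (hPB : Pᵀ * B.map (fun x : ℤ => (x : ℝ)) * P = diagonal w) (hi : w i < 0) (hj : w j < 0) :
    ∃ z, negGram B u z < 0 := by
  set f := Int.castRingHom ℝ
  change Pᵀ * B.map f * P = diagonal w at hPB
  have hmap : (negGramMatrix B u).map f = negGramMatrix (B.map f) (f ∘ u) := negGramMatrix_map f B u
  have hplane (a b : ℝ) : (a • P.col i + b • P.col j) ⬝ᵥ B.map f *ᵥ (a • P.col i + b • P.col j) =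
      a ^ 2 * w i + b ^ 2 * w j := by
    simp only [mulVec_add, mulVec_smul, dotProduct_add, dotProduct_smul, add_dotProduct,
      smul_dotProduct, smul_eq_mul, col_dotProduct_mulVec_col, hPB, diagonal_apply_eq,
      diagonal_apply_ne _ hij, diagonal_apply_ne _ hij.symm]
    ring
  obtain ⟨a, b, hab, hperp⟩ : ∃ a b : ℝ, 0 < a ^ 2 + b ^ 2 ∧
      (f ∘ u) ⬝ᵥ B.map f *ᵥ (a • P.col i + b • P.col j) = 0 := by
    simp only [mulVec_add, mulVec_smul, dotProduct_add, dotProduct_smul, smul_eq_mul]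
    generalize (f ∘ u) ⬝ᵥ B.map f *ᵥ P.col i = c
    generalize (f ∘ u) ⬝ᵥ B.map f *ᵥ P.col j = d
    by_cases hc : c = 0
    · exact ⟨1, 0, by norm_num, by simp [hc]⟩
    · exact ⟨d, -c, by rw [neg_sq]; positivity, by ring⟩
  obtain ⟨z, hz⟩ := exists_int_dotProduct_mulVec_neg (negGramMatrix B u)
    (x := a • P.col i + b • P.col j) (by
    change _ ⬝ᵥ (negGramMatrix B u).map f *ᵥ _ < 0
    rw [hmap, dotProduct_negGramMatrix_mulVec, negGram, hperp, hplane, map_dotProduct_mulVec]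
    have huR : f (u ⬝ᵥ B *ᵥ u) < 0 := Int.cast_lt_zero.2 hu
    have hneg : a ^ 2 * w i + b ^ 2 * w j < 0 := by
      rcases eq_or_ne a 0 with rfl | ha
      · have hb : 0 < b ^ 2 := by simpa using hab
        nlinarith
      · have ha : 0 < a ^ 2 := by positivity
        nlinarith [sq_nonneg b]
    nlinarith [mul_pos_of_neg_of_neg huR hneg])
  exact ⟨z, by rwa [dotProduct_negGramMatrix_mulVec] at hz⟩

end Signature

/-- Zariski density of finite-index subgroups of lattice orthogonal groups
(Friedman–Morgan): let `L = ℤ^{r+s}` carry a nondegenerate symmetric bilinear form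
given by a symmetric integer matrix `B` of signature `(r,s)` with `r ≥ 3`, `s ≥ 2`.
If `D ⊆ SO(L,B)` is a subgroup of finite index, then `D` is Zariski dense in the
complex algebraic group `SO(V,B)`, `V = L ⊗ ℂ`: every polynomial in the matrix
entries vanishing on `D` vanishes on all complex matrices `g` with `gᵀBg = B` and
`det g = 1`. -/
theorem stmt_13 (r s : ℕ) (hr : 3 ≤ r) (hs : 2 ≤ s)
    (B : Matrix (Fin (r + s)) (Fin (r + s)) ℤ)
    (hBsymm : B.transpose = B)
    (hBdet : B.det ≠ 0)
    -- signature (r, s): over ℝ, B is congruent to diag(1,…,1,-1,…,-1)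
    (hsig : ∃ P : Matrix (Fin (r + s)) (Fin (r + s)) ℝ, P.det ≠ 0 ∧
      P.transpose * B.map (fun x : ℤ => (x : ℝ)) * P =
        Matrix.diagonal fun i : Fin (r + s) => if (i : ℕ) < r then (1 : ℝ) else -1)
    (D : Set (Matrix (Fin (r + s)) (Fin (r + s)) ℤ))
    -- D is a subgroup of SO(L, B)
    (hD_SO : ∀ g ∈ D, g.transpose * B * g = B ∧ g.det = 1)
    (hD_one : (1 : Matrix (Fin (r + s)) (Fin (r + s)) ℤ) ∈ D)
    (hD_mul : ∀ g ∈ D, ∀ h ∈ D, g * h ∈ D)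
    (hD_inv : ∀ g ∈ D, ∃ h ∈ D, g * h = 1 ∧ h * g = 1)
    -- D has finite index in SO(L, B)
    (hfinindex : ∃ T : Finset (Matrix (Fin (r + s)) (Fin (r + s)) ℤ),
      ∀ g : Matrix (Fin (r + s)) (Fin (r + s)) ℤ,
        g.transpose * B * g = B → g.det = 1 → ∃ t ∈ T, ∃ d ∈ D, g = t * d) :
    ∀ p : MvPolynomial (Fin (r + s) × Fin (r + s)) ℂ,
      (∀ d ∈ D, MvPolynomial.eval (fun ij => ((d ij.1 ij.2 : ℤ) : ℂ)) p = 0) →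
      ∀ g : Matrix (Fin (r + s)) (Fin (r + s)) ℂ,
        g.transpose * B.map (fun x : ℤ => (x : ℂ)) * g =
          B.map (fun x : ℤ => (x : ℂ)) → g.det = 1 →
        MvPolynomial.eval (fun ij => g ij.1 ij.2) p = 0 := by
  obtain ⟨P, hP, hPB⟩ := hsig
  obtain ⟨T, hT⟩ := hfinindex
  have hsign (i : Fin (r + s)) : (if (i : ℕ) < r then (1 : ℝ) else -1) ≠ 0 := by
    split_ifs <;> norm_num
  have hD_pow (γ : Matrix (Fin (r + s)) (Fin (r + s)) ℤ) (hγ : γᵀ * B * γ = B)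
      (hγ_det : γ.det = 1) : ∃ k, 0 < k ∧ γ ^ k ∈ D := by
    refine exists_pow_mem_of_finite_cosets hD_mul hD_inv T hγ_det
      fun n => hT _ ?_ (by simp [hγ_det])
    induction n with
    | zero => simp
    | succ n ih =>
      calc _ = γᵀ * ((γ ^ n)ᵀ * B * γ ^ n) * γ := by
            simp only [pow_succ, transpose_mul, Matrix.mul_assoc]
        _ = B := by rw [ih, hγ]
  obtain ⟨u, hu⟩ := exists_int_dotProduct_mulVec_neg B (x := P.col ⟨r, by omega⟩) (by
    rw [col_dotProduct_mulVec_col, hPB]; simp)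
  obtain ⟨v, hv⟩ := exists_int_dotProduct_mulVec_neg (-B) (x := P.col ⟨0, by omega⟩) (by
    have h : (-B).map (fun a : ℤ => (a : ℝ)) = -B.map fun a : ℤ => (a : ℝ) := by ext; simp
    rw [h, neg_mulVec, dotProduct_neg, col_dotProduct_mulVec_col, hPB]
    simp [show 0 < r by omega])
  rw [neg_mulVec, dotProduct_neg, neg_lt_zero] at hv
  have hpos : 0 < negGram B u v := by
    rw [negGram]
    nlinarith [sq_nonneg (u ⬝ᵥ B *ᵥ v), mul_pos (neg_pos.2 hu) hv]
  obtain ⟨z, hz⟩ : ∃ z, negGram B u z < 0 :=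
    exists_negGram_neg hu (i := ⟨r, by omega⟩) (j := ⟨r + 1, by omega⟩) (by simp) hPB
      (by simp) (by simp)
  have hBC : (B.map (Int.castRingHom ℂ))ᵀ = B.map (Int.castRingHom ℂ) := by
    rw [← transpose_map, hBsymm]
  have hPC : (P.map Complex.ofRealHom)ᵀ * B.map (Int.castRingHom ℂ) * P.map Complex.ofRealHom =
      diagonal fun i : Fin (r + s) => Complex.ofRealHom (if (i : ℕ) < r then (1 : ℝ) else -1) := by
    have h := congrArg (fun M => M.map Complex.ofRealHom) hPB
    simp only [Matrix.map_mul, diagonal_map, map_zero] at h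
    rw [← transpose_map]
    convert h using 3
    ext i j
    simp
  have hS_one : 1 ∈ (fun d => d.map (Int.castRingHom ℂ)) '' D :=
    ⟨1, hD_one, Matrix.map_one _ (map_zero _) (map_one _)⟩
  have hS_mul : ∀ g ∈ (fun d => d.map (Int.castRingHom ℂ)) '' D,
      ∀ h ∈ (fun d => d.map (Int.castRingHom ℂ)) '' D,
      g * h ∈ (fun d => d.map (Int.castRingHom ℂ)) '' D := by
    rintro _ ⟨d, hd, rfl⟩ _ ⟨e, he, rfl⟩
    exact ⟨d * e, hD_mul d hd e he, Matrix.map_mul⟩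
  intro p hp g hg hg_det
  have hmem : g ∈ zariskiClosure ((fun d => d.map (Int.castRingHom ℂ)) '' D) := by
    refine mem_of_forall_mul_formReflection_mem hBC (P := P.map Complex.ofRealHom) ?_ (fun i => ?_)
      hPC (subset_zariskiClosure _ hS_one)
      (fun _ hg _ hh => mul_mem_zariskiClosure hS_mul hg hh)
      (u := Int.castRingHom ℂ ∘ u) ?_ (fun x hx => ?_) hg hg_det
    · have h := Complex.ofRealHom.map_det P
      change _ = (P.map Complex.ofRealHom).det at h
      rw [← h]
      exact (map_ne_zero _).2 hP
    · exact (map_ne_zero _).2 (hsign i)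
    · rw [map_dotProduct_mulVec]
      exact (map_ne_zero_iff _ Int.cast_injective).2 hu.ne
    · exact mul_formReflection_mem_of_indefinite hBsymm ⟨v, hpos⟩ ⟨z, hz⟩
        (fun y => mul_formReflection_mem_of_not_isSquare hBsymm hD_one hD_mul hD_pow hu.ne) hx
  refine hmem p ?_
  rintro _ ⟨d, hd, rfl⟩
  exact hp d hd
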